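/- Assume f satisfies condition (OSC). There exist constants C₁₇, C₁₈, C₁₉ > 0, depending only on n, Ω, Ω̃ and f, such that every uniformly convex solution u ∈ C^{2,α}(Ω̄) (0 < α < 1) of the second boundary value problem with data (f, c) satisfies: D²u(x) ≤ C₁₇·Iₙ for all x ∈ Ω̄, and C₁₈ ≤ trace(D²u(x)) = u₁₁(x) + ⋯ + uₙₙ(x) ≤ C₁₉ for all x ∈ Ω̄. -/

import Mathlib

open Set MeasureTheory Matrix
open scoped Topology RealInnerProductSpace NNReal

noncomputable section

abbrev Euc (n : ℕ) := EuclideanSpace ℝ (Fin n)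

variable {n : ℕ}

/-- Hessian matrix of `u` at `x`. -/
def Hess (u : Euc n → ℝ) (x : Euc n) : Matrix (Fin n) (Fin n) ℝ :=
  fun i j => iteratedFDeriv ℝ 2 u x ![EuclideanSpace.single i 1, EuclideanSpace.single j 1]

/-- `A ≤ B` in the sense of symmetric matrices. -/
def MatLE (A B : Matrix (Fin n) (Fin n) ℝ) : Prop := (B - A).PosSemidef

/-- The Minkowski mean-curvature operator `div (∇u / √(1 - |∇u|²))`. -/
def MinkDiv (u : Euc n → ℝ) (x : Euc n) : ℝ :=
  ∑ i, fderiv ℝ (fun y => (Real.sqrt (1 - ‖gradient u y‖ ^ 2))⁻¹ * gradient u y i) x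
    (EuclideanSpace.single i 1)

/-- The Euclidean mean-curvature operator `div (∇u / √(1 + |∇u|²))`. -/
def EucDiv (u : Euc n → ℝ) (x : Euc n) : ℝ :=
  ∑ i, fderiv ℝ (fun y => (Real.sqrt (1 + ‖gradient u y‖ ^ 2))⁻¹ * gradient u y i) x
    (EuclideanSpace.single i 1)

/-- `S(p) = (1/v)(Iₙ + p pᵀ / v²)`, `v = √(1-|p|²)`. -/
def Smat (p : Euc n) : Matrix (Fin n) (Fin n) ℝ :=
  (Real.sqrt (1 - ‖p‖ ^ 2))⁻¹ •
    ((1 : Matrix (Fin n) (Fin n) ℝ) +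
      (1 - ‖p‖ ^ 2)⁻¹ • Matrix.vecMulVec (fun i => p i) (fun j => p j))

/-- `B(p) = Iₙ + p pᵀ / (v (1 + v))`, `v = √(1-|p|²)`. -/
def Bmat (p : Euc n) : Matrix (Fin n) (Fin n) ℝ :=
  (1 : Matrix (Fin n) (Fin n) ℝ) +
    (Real.sqrt (1 - ‖p‖ ^ 2) * (1 + Real.sqrt (1 - ‖p‖ ^ 2)))⁻¹ •
      Matrix.vecMulVec (fun i => p i) (fun j => p j)

/-- `A(x) = (1/v)·B(∇u)·D²u·B(∇u)`: its eigenvalues are the principal curvatures. -/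
def Amat (u : Euc n → ℝ) (x : Euc n) : Matrix (Fin n) (Fin n) ℝ :=
  (Real.sqrt (1 - ‖gradient u x‖ ^ 2))⁻¹ •
    (Bmat (gradient u x) * Hess u x * Bmat (gradient u x))

/-- supremum of the quadratic form of `A` over the unit sphere (the operator
norm / largest eigenvalue for a positive semidefinite symmetric `A`). -/
def quadSup (A : Matrix (Fin n) (Fin n) ℝ) : ℝ :=
  ⨆ ξ : Metric.sphere (0 : Euc n) 1,
    (fun i => (ξ : Euc n) i) ⬝ᵥ A.mulVec (fun i => (ξ : Euc n) i)

/-- The domains `Ω = {h̃ > 0}`, `Ω̃ = {h > 0}` are bounded uniformly convex domains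
with smooth boundary, described by the defining functions `h̃` and `h`. -/
def DomainSetup (Ω Ωt : Set (Euc n)) (ht h : Euc n → ℝ) (θt θ : ℝ) : Prop :=
  IsOpen Ω ∧ IsOpen Ωt ∧ Bornology.IsBounded Ω ∧ Bornology.IsBounded Ωt ∧
  Ω.Nonempty ∧ Ωt.Nonempty ∧
  ContDiff ℝ (⊤ : ℕ∞) ht ∧ ContDiff ℝ (⊤ : ℕ∞) h ∧
  Ω = {x | 0 < ht x} ∧ Ωt = {y | 0 < h y} ∧
  (∀ x ∈ frontier Ω, ‖gradient ht x‖ = 1) ∧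
  (∀ y ∈ frontier Ωt, ‖gradient h y‖ = 1) ∧
  0 < θt ∧ 0 < θ ∧
  (∀ x : Euc n, MatLE (Hess ht x) ((-θt) • (1 : Matrix (Fin n) (Fin n) ℝ))) ∧
  (∀ y : Euc n, MatLE (Hess h y) ((-θ) • (1 : Matrix (Fin n) (Fin n) ℝ)))

/-- `f ∈ 𝒜`: `f` is `C²` on `Ω̄ × closure Ω̃` and concave in `x`. -/
def InA (Ω Ωt : Set (Euc n)) (f : Euc n × Euc n → ℝ) : Prop :=
  ContDiffOn ℝ 2 f (closure Ω ×ˢ closure Ωt) ∧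
  ∀ p ∈ closure Ωt, ConcaveOn ℝ (closure Ω) (fun x => f (x, p))

/-- Condition (OSC): `osc f ≤ (n/2)(|Ω̃|/|Ω|)^{1/n}`. -/
def OSCcond (Ω Ωt : Set (Euc n)) (f : Euc n × Euc n → ℝ) : Prop :=
  ∀ x ∈ closure Ω, ∀ y ∈ closure Ω, ∀ p ∈ closure Ωt, ∀ q ∈ closure Ωt,
    |f (x, p) - f (y, q)| ≤
      ((n : ℝ) / 2) * ((volume Ωt).toReal / (volume Ω).toReal) ^ ((1 : ℝ) / n)

/-- `‖f‖_{C²(Ω̄ × closure Ω̃)} ≤ K`. -/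
def C2Bound (Ω Ωt : Set (Euc n)) (f : Euc n × Euc n → ℝ) (K : ℝ) : Prop :=
  ContDiffOn ℝ 2 f (closure Ω ×ˢ closure Ωt) ∧
  ∀ z ∈ closure Ω ×ˢ closure Ωt,
    |f z| ≤ K ∧ ‖fderiv ℝ f z‖ ≤ K ∧ ‖iteratedFDeriv ℝ 2 f z‖ ≤ K

/-- `sup |D_x f| ≤ ε` on `Ω̄ × closure Ω̃`. -/
def DxBound (Ω Ωt : Set (Euc n)) (f : Euc n × Euc n → ℝ) (ε : ℝ) : Prop :=
  ∀ x ∈ closure Ω, ∀ p ∈ closure Ωt, ‖fderiv ℝ (fun x' => f (x', p)) x‖ ≤ ε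

/-- `sup |D_{xp} f| ≤ ε` on `Ω̄ × closure Ω̃`. -/
def DxpBound (Ω Ωt : Set (Euc n)) (f : Euc n × Euc n → ℝ) (ε : ℝ) : Prop :=
  ∀ x ∈ closure Ω, ∀ p ∈ closure Ωt,
    ‖fderiv ℝ (fun p' => fderiv ℝ (fun x' => f (x', p')) x) p‖ ≤ ε

/-- A strictly convex solution of the second boundary value problem. -/
def IsStrictSol (Ω Ωt : Set (Euc n)) (f : Euc n × Euc n → ℝ) (c : ℝ) (u : Euc n → ℝ) : Prop :=
  ContDiffOn ℝ 2 u (closure Ω) ∧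
  (∀ x ∈ closure Ω, (Hess u x).PosDef) ∧
  (∀ x ∈ closure Ω, ‖gradient u x‖ < 1) ∧
  (∀ x ∈ Ω, MinkDiv u x = f (x, gradient u x) + c) ∧
  gradient u '' Ω = Ωt

/-- A smooth uniformly convex solution of the second boundary value problem. -/
def IsSmoothSol (Ω Ωt : Set (Euc n)) (f : Euc n × Euc n → ℝ) (c : ℝ) (u : Euc n → ℝ) : Prop :=
  ContDiffOn ℝ (⊤ : ℕ∞) u (closure Ω) ∧
  (∃ δ : ℝ, 0 < δ ∧ ∀ x ∈ closure Ω, MatLE (δ • (1 : Matrix (Fin n) (Fin n) ℝ)) (Hess u x)) ∧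
  (∀ x ∈ closure Ω, ‖gradient u x‖ < 1) ∧
  (∀ x ∈ Ω, MinkDiv u x = f (x, gradient u x) + c) ∧
  gradient u '' Ω = Ωt

/-- A uniformly convex `C^{2}` solution of the second boundary value problem. -/
def IsUCSol (Ω Ωt : Set (Euc n)) (f : Euc n × Euc n → ℝ) (c : ℝ) (u : Euc n → ℝ) : Prop :=
  ContDiffOn ℝ 2 u (closure Ω) ∧
  (∃ δ : ℝ, 0 < δ ∧ ∀ x ∈ closure Ω, MatLE (δ • (1 : Matrix (Fin n) (Fin n) ℝ)) (Hess u x)) ∧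
  (∀ x ∈ closure Ω, ‖gradient u x‖ < 1) ∧
  (∀ x ∈ Ω, MinkDiv u x = f (x, gradient u x) + c) ∧
  gradient u '' Ω = Ωt

/-- A uniformly convex `C^{4,α}` solution of the second boundary value problem
for the Minkowski mean-curvature operator. -/
def IsC4Sol (Ω Ωt : Set (Euc n)) (f : Euc n × Euc n → ℝ) (c : ℝ) (u : Euc n → ℝ)
    (α : ℝ) : Prop :=
  ContDiffOn ℝ 4 u (closure Ω) ∧
  (∃ C : ℝ≥0, HolderOnWith C (Real.toNNReal α) (fun x => iteratedFDeriv ℝ 4 u x) (closure Ω)) ∧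
  (∃ δ : ℝ, 0 < δ ∧ ∀ x ∈ closure Ω, MatLE (δ • (1 : Matrix (Fin n) (Fin n) ℝ)) (Hess u x)) ∧
  (∀ x ∈ closure Ω, ‖gradient u x‖ < 1) ∧
  (∀ x ∈ Ω, MinkDiv u x = f (x, gradient u x) + c) ∧
  gradient u '' Ω = Ωt

/-- A uniformly convex `C^{4,α}` solution of the second boundary value problem
for the Euclidean mean-curvature operator. -/
def IsC4SolE (Ω Ωt : Set (Euc n)) (f : Euc n × Euc n → ℝ) (c : ℝ) (u : Euc n → ℝ)
    (α : ℝ) : Prop :=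
  ContDiffOn ℝ 4 u (closure Ω) ∧
  (∃ C : ℝ≥0, HolderOnWith C (Real.toNNReal α) (fun x => iteratedFDeriv ℝ 4 u x) (closure Ω)) ∧
  (∃ δ : ℝ, 0 < δ ∧ ∀ x ∈ closure Ω, MatLE (δ • (1 : Matrix (Fin n) (Fin n) ℝ)) (Hess u x)) ∧
  (∀ x ∈ Ω, EucDiv u x = f (x, gradient u x) + c) ∧
  gradient u '' Ω = Ωt

/-- `ũ` is the Legendre transform of `u`. -/
def IsLegendre (Ω Ωt : Set (Euc n)) (u ut : Euc n → ℝ) : Prop :=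
  ContDiffOn ℝ (⊤ : ℕ∞) ut (closure Ωt) ∧
  (∀ x ∈ closure Ω, ut (gradient u x) = ⟪x, gradient u x⟫ - u x) ∧
  (∀ x ∈ closure Ω, gradient ut (gradient u x) = x) ∧
  (∀ x ∈ closure Ω, Hess ut (gradient u x) = (Hess u x)⁻¹)

/-- A positive semidefinite quadratic form is bounded by the trace. -/
lemma Matrix.PosSemidef.dotProduct_mulVec_le_trace_mul {H : Matrix (Fin n) (Fin n) ℝ}
    (hH : H.PosSemidef) (p : Fin n → ℝ) :
    p ⬝ᵥ H *ᵥ p ≤ H.trace * (p ⬝ᵥ p) := by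
  obtain ⟨B, rfl⟩ : ∃ B : Matrix (Fin n) (Fin n) ℝ, H = Bᴴ * B := by
    open scoped MatrixOrder in
    exact CStarAlgebra.nonneg_iff_eq_star_mul_self.mp hH.nonneg
  have hquad : p ⬝ᵥ (Bᴴ * B) *ᵥ p = ∑ i, (∑ j, B i j * p j) ^ 2 := by
    rw [← Matrix.mulVec_mulVec, Matrix.dotProduct_mulVec, Matrix.vecMul_conjTranspose]
    simp [dotProduct, mulVec, sq]
  have htrace : (Bᴴ * B).trace = ∑ i, ∑ j, B i j ^ 2 := by
    rw [Finset.sum_comm]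
    simp [Matrix.trace, Matrix.mul_apply, sq]
  rw [hquad, htrace, Finset.sum_mul]
  refine Finset.sum_le_sum fun i _ => ?_
  simpa [dotProduct, sq] using Finset.sum_mul_sq_le_sq_mul_sq Finset.univ (B i) p

lemma Matrix.PosSemidef.le_trace_smul_one {H : Matrix (Fin n) (Fin n) ℝ} (hH : H.PosSemidef)
    {C : ℝ} (hC : H.trace ≤ C) : MatLE H (C • 1) := by
  refine Matrix.PosSemidef.of_dotProduct_mulVec_nonneg
    ((Matrix.isHermitian_one.smul (by simp [IsSelfAdjoint])).sub hH.1) fun p => ?_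
  have hp : 0 ≤ p ⬝ᵥ p := Finset.sum_nonneg fun i _ => mul_self_nonneg (p i)
  have hle := hH.dotProduct_mulVec_le_trace_mul p
  simp only [star_trivial, Matrix.sub_mulVec, Matrix.smul_mulVec, Matrix.one_mulVec,
    dotProduct_sub, dotProduct_smul, smul_eq_mul]
  nlinarith

/-- The arithmetic-geometric mean inequality for the eigenvalues. -/
lemma Matrix.PosSemidef.det_le_trace_div_pow {H : Matrix (Fin n) (Fin n) ℝ} (hn : 0 < n)
    (hH : H.PosSemidef) : H.det ≤ (H.trace / n) ^ n := by
  have hnR : (0 : ℝ) < n := by exact_mod_cast hn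
  have hmean := Real.geom_mean_le_arith_mean Finset.univ (fun _ => (1 : ℝ)) hH.1.eigenvalues
    (by simp) (by simpa using hn) (fun i _ => hH.eigenvalues_nonneg i)
  simp only [Real.rpow_one, Finset.sum_const, Finset.card_univ, Fintype.card_fin, nsmul_eq_mul,
    mul_one, one_mul] at hmean
  have hprod : 0 ≤ ∏ i, hH.1.eigenvalues i :=
    Finset.prod_nonneg fun i _ => hH.eigenvalues_nonneg i
  rw [hH.1.det_eq_prod_eigenvalues, hH.1.trace_eq_sum_eigenvalues]
  simp only [RCLike.ofReal_real_eq_id, id]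
  calc ∏ i, hH.1.eigenvalues i = ((∏ i, hH.1.eigenvalues i) ^ ((n : ℝ)⁻¹)) ^ n :=
        (Real.rpow_inv_natCast_pow hprod hn.ne').symm
    _ ≤ _ := pow_le_pow_left₀ (by positivity) hmean n

lemma posSemidef_of_smul_one_matLE {H : Matrix (Fin n) (Fin n) ℝ} {δ : ℝ} (hδ : 0 < δ)
    (hH : MatLE (δ • 1) H) : H.PosSemidef := by
  have h := Matrix.PosSemidef.add hH (Matrix.PosSemidef.one.smul hδ.le)
  rwa [sub_add_cancel] at h

lemma Hess_apply (u : Euc n → ℝ) (x : Euc n) (i j : Fin n) :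
    Hess u x i j = fderiv ℝ (fderiv ℝ u) x (EuclideanSpace.single i 1)
      (EuclideanSpace.single j 1) := by
  simp [Hess, iteratedFDeriv_two_apply]

lemma gradient_apply (u : Euc n → ℝ) (y : Euc n) (j : Fin n) :
    gradient u y j = fderiv ℝ u y (EuclideanSpace.single j 1) := by
  have h := InnerProductSpace.toDual_symm_apply (𝕜 := ℝ) (y := fderiv ℝ u y)
    (x := (EuclideanSpace.single j (1 : ℝ) : Euc n))
  rw [EuclideanSpace.inner_single_right] at h
  simpa [gradient] using h

/-- The derivative of the gradient map. -/
def gradDeriv (u : Euc n → ℝ) (x : Euc n) : Euc n →L[ℝ] Euc n :=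
  (EuclideanSpace.equiv (Fin n) ℝ).symm.toContinuousLinearMap ∘L
    ContinuousLinearMap.pi fun j =>
      (fderiv ℝ (fderiv ℝ u) x).flip (EuclideanSpace.single j 1)

lemma gradDeriv_apply (u : Euc n → ℝ) (x w : Euc n) (j : Fin n) :
    gradDeriv u x w j = fderiv ℝ (fderiv ℝ u) x w (EuclideanSpace.single j 1) := rfl

lemma gradDeriv_single (u : Euc n → ℝ) (x : Euc n) (i j : Fin n) :
    gradDeriv u x (EuclideanSpace.single i 1) j = Hess u x i j := by
  rw [Hess_apply, gradDeriv_apply]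

lemma ContDiffAt.differentiableAt_fderiv_two {u : Euc n → ℝ} {x : Euc n}
    (hu : ContDiffAt ℝ 2 u x) : DifferentiableAt ℝ (fderiv ℝ u) x :=
  (hu.fderiv_right (m := 1) (by norm_num)).differentiableAt (by norm_num)

lemma ContDiffAt.hasFDerivAt_gradient {u : Euc n → ℝ} {x : Euc n} (hu : ContDiffAt ℝ 2 u x) :
    HasFDerivAt (gradient u) (gradDeriv u x) x := by
  rw [← hasFDerivWithinAt_univ, hasFDerivWithinAt_euclidean]
  intro j
  rw [hasFDerivWithinAt_univ]
  simp only [gradient_apply]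
  exact (ContinuousLinearMap.apply ℝ ℝ
    (EuclideanSpace.single j (1 : ℝ) : Euc n)).hasFDerivAt.comp x hu.differentiableAt_fderiv_two.hasFDerivAt

lemma det_gradDeriv (u : Euc n → ℝ) (x : Euc n) : (gradDeriv u x).det = (Hess u x).det := by
  rw [ContinuousLinearMap.det,
    ← LinearMap.det_toMatrix (EuclideanSpace.basisFun (Fin n) ℝ).toBasis, ← Matrix.det_transpose]
  congr 1
  ext i j
  simp [LinearMap.toMatrix_apply, gradDeriv_single]

/-- The Minkowski mean-curvature operator in nondivergence form. -/
lemma minkDiv_eq {u : Euc n → ℝ} {x : Euc n} (hu : ContDiffAt ℝ 2 u x)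
    (hx : ‖gradient u x‖ < 1) :
    MinkDiv u x = (√(1 - ‖gradient u x‖ ^ 2))⁻¹ * (Hess u x).trace +
      (√(1 - ‖gradient u x‖ ^ 2))⁻¹ ^ 3 *
        ((gradient u x).ofLp ⬝ᵥ Hess u x *ᵥ (gradient u x).ofLp) := by
  have hs : 0 < 1 - ‖gradient u x‖ ^ 2 := by nlinarith [norm_nonneg (gradient u x)]
  have hG := hu.hasFDerivAt_gradient
  set v := √(1 - ‖gradient u x‖ ^ 2) with hv
  have hv0 : 0 < v := Real.sqrt_pos.mpr hs
  have hφ : HasFDerivAt (fun y => (√(1 - ‖gradient u y‖ ^ 2))⁻¹)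
      ((-(1 / (2 * v)) / v ^ 2) •
        -(2 • (innerSL ℝ (gradient u x) ∘L gradDeriv u x) : Euc n →L[ℝ] ℝ)) x :=
    ((Real.hasDerivAt_sqrt hs.ne').fun_inv hv0.ne').comp_hasFDerivAt
      (f := fun y => 1 - ‖gradient u y‖ ^ 2) x (hG.norm_sq.const_sub 1)
  have hterm : ∀ i, fderiv ℝ (fun y => (√(1 - ‖gradient u y‖ ^ 2))⁻¹ * gradient u y i) x
      (EuclideanSpace.single i 1) = v⁻¹ * Hess u x i i +
        v⁻¹ ^ 3 * (gradient u x i * ∑ j, Hess u x i j * gradient u x j) := by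
    intro i
    have hGi : HasFDerivAt (fun y => gradient u y i)
        ((EuclideanSpace.proj i : Euc n →L[ℝ] ℝ) ∘L gradDeriv u x) x :=
      (EuclideanSpace.proj i : Euc n →L[ℝ] ℝ).hasFDerivAt.comp x hG
    rw [(hφ.fun_mul hGi).fderiv]
    simp only [_root_.add_apply, _root_.smul_apply, _root_.neg_apply, ContinuousLinearMap.comp_apply,
      innerSL_apply_apply, PiLp.proj_apply, gradDeriv_single, smul_eq_mul, nsmul_eq_mul,
      PiLp.inner_apply, RCLike.inner_apply, conj_trivial, ← hv]
    field_simp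
    push_cast
    ring
  rw [MinkDiv, Finset.sum_congr rfl fun i _ => hterm i, Finset.sum_add_distrib,
    ← Finset.mul_sum, ← Finset.mul_sum]
  rfl

lemma trace_le_minkDiv {u : Euc n → ℝ} {x : Euc n} (hu : ContDiffAt ℝ 2 u x)
    (hx : ‖gradient u x‖ < 1) (hH : (Hess u x).PosSemidef) :
    (Hess u x).trace ≤ MinkDiv u x := by
  have hs : 0 < 1 - ‖gradient u x‖ ^ 2 := by nlinarith [norm_nonneg (gradient u x)]
  have hquad := hH.dotProduct_mulVec_nonneg (gradient u x).ofLp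
  rw [star_trivial] at hquad
  rw [minkDiv_eq hu hx]
  have hv : 1 ≤ (√(1 - ‖gradient u x‖ ^ 2))⁻¹ :=
    (one_le_inv₀ (Real.sqrt_pos.mpr hs)).mpr
      (Real.sqrt_le_one.mpr (by nlinarith [sq_nonneg ‖gradient u x‖]))
  nlinarith [mul_le_mul_of_nonneg_right hv hH.trace_nonneg,
    mul_nonneg (pow_nonneg (zero_le_one.trans hv) 3) hquad]

lemma minkDiv_le_mul_trace {u : Euc n → ℝ} {x : Euc n} {r : ℝ} (hu : ContDiffAt ℝ 2 u x)
    (hr : r < 1) (hx : ‖gradient u x‖ ≤ r) (hH : (Hess u x).PosSemidef) :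
    MinkDiv u x ≤ (√(1 - r ^ 2))⁻¹ ^ 3 * (Hess u x).trace := by
  have hr0 : 0 ≤ r := (norm_nonneg _).trans hx
  have hsr : 0 < 1 - r ^ 2 := by nlinarith
  have hle : 1 - r ^ 2 ≤ 1 - ‖gradient u x‖ ^ 2 := by nlinarith [norm_nonneg (gradient u x)]
  have hs := hsr.trans_le hle
  have hquad := hH.dotProduct_mulVec_le_trace_mul (gradient u x).ofLp
  have hnorm : (gradient u x).ofLp ⬝ᵥ (gradient u x).ofLp = ‖gradient u x‖ ^ 2 := by
    rw [EuclideanSpace.real_norm_sq_eq]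
    simp [dotProduct, sq]
  rw [hnorm] at hquad
  rw [minkDiv_eq hu (hx.trans_lt hr)]
  have hvv : (√(1 - r ^ 2))⁻¹ ≥ (√(1 - ‖gradient u x‖ ^ 2))⁻¹ :=
    inv_anti₀ (Real.sqrt_pos.mpr hsr) (Real.sqrt_le_sqrt hle)
  have hsq := Real.sq_sqrt hs.le
  have hv0 := Real.sqrt_pos.mpr hs
  set v := √(1 - ‖gradient u x‖ ^ 2)
  calc v⁻¹ * (Hess u x).trace + v⁻¹ ^ 3 * _
      ≤ v⁻¹ * (Hess u x).trace + v⁻¹ ^ 3 * ((Hess u x).trace * ‖gradient u x‖ ^ 2) := by gcongr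
    _ = v⁻¹ ^ 3 * (Hess u x).trace := by
      rw [show ‖gradient u x‖ ^ 2 = 1 - v ^ 2 by linarith]
      field_simp
      ring
    _ ≤ _ := by
      have := hH.trace_nonneg
      gcongr

/-- The second-order necessary condition at a local maximum on the line. -/
lemma IsLocalMax.deriv_deriv_nonpos {φ : ℝ → ℝ} {a : ℝ} (hmax : IsLocalMax φ a)
    (hcont : ContinuousAt φ a) : deriv (deriv φ) a ≤ 0 := by
  by_contra! hpos
  have hmin := isLocalMin_of_deriv_deriv_pos hpos hmax.deriv_eq_zero hcont
  have hconst : φ =ᶠ[𝓝 a] fun _ => φ a := by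
    filter_upwards [hmax, hmin] with t h₁ h₂ using le_antisymm h₁ h₂
  have := hconst.deriv.deriv_eq
  simp at this
  linarith

/-- The Hessian at a point where a paraboloid touches `u` from above. -/
lemma Hess_diag_le_of_isLocalMax {u : Euc n → ℝ} {x y : Euc n} {A : ℝ}
    (hu : ContDiffAt ℝ 2 u x) (hmax : IsLocalMax (fun z => u z - A * ‖z - y‖ ^ 2) x)
    (i : Fin n) : Hess u x i i ≤ 2 * A := by
  set e : Euc n := EuclideanSpace.single i 1 with he
  have hline : ∀ t : ℝ, HasDerivAt (fun t : ℝ => x + t • e) e t := fun t => by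
    simpa using ((hasDerivAt_id t).smul_const e).const_add x
  have hline0 : Filter.Tendsto (fun t : ℝ => x + t • e) (𝓝 0) (𝓝 x) := by
    simpa using (hline 0).continuousAt.tendsto
  have hinner : ∀ t : ℝ, HasDerivAt (fun t : ℝ => ‖x + t • e - y‖ ^ 2)
      (2 * ⟪x + t • e - y, e⟫) t := fun t => ((hline t).sub_const y).norm_sq
  have hee : ‖e‖ = 1 := by simp [he]
  have hdiff : ∀ᶠ z in 𝓝 x, DifferentiableAt ℝ u z :=
    (hu.eventually (by simp)).mono fun z hz => hz.differentiableAt (by norm_num)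
  have hderiv : deriv (fun t : ℝ => u (x + t • e) - A * ‖x + t • e - y‖ ^ 2) =ᶠ[𝓝 0]
      fun t => fderiv ℝ u (x + t • e) e - A * (2 * ⟪x + t • e - y, e⟫) := by
    filter_upwards [hline0.eventually hdiff] with t ht
    exact ((ht.hasFDerivAt.comp_hasDerivAt t (hline t)).sub
      ((hinner t).const_mul A)).deriv
  have hsecond : HasDerivAt
      (fun t : ℝ => fderiv ℝ u (x + t • e) e - A * (2 * ⟪x + t • e - y, e⟫))
      (Hess u x i i - A * (2 * 1)) 0 := by
    rw [Hess_apply]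
    have h1 : HasDerivAt (fun t : ℝ => fderiv ℝ u (x + t • e))
        (fderiv ℝ (fderiv ℝ u) x e) 0 := by
      refine HasFDerivAt.comp_hasDerivAt (f := fun t : ℝ => x + t • e) 0 ?_ (hline 0)
      simpa using hu.differentiableAt_fderiv_two.hasFDerivAt
    have h2 : HasDerivAt (fun t : ℝ => ⟪x + t • e - y, e⟫) 1 0 := by
      simpa [hee] using ((hline 0).sub_const y).inner ℝ (hasDerivAt_const (0 : ℝ) e)
    exact (by simpa using h1.clm_apply (hasDerivAt_const (0 : ℝ) e) :
      HasDerivAt (fun t : ℝ => fderiv ℝ u (x + t • e) e) _ 0).sub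
        ((h2.const_mul 2).const_mul A)
  have hmax0 : IsLocalMax (fun t : ℝ => u (x + t • e) - A * ‖x + t • e - y‖ ^ 2) 0 := by
    have := hline0.eventually hmax
    filter_upwards [this] with t ht
    simpa using ht
  have hcont : ContinuousAt (fun t : ℝ => u (x + t • e) - A * ‖x + t • e - y‖ ^ 2) 0 := by
    refine ContinuousAt.sub ?_ ((hinner 0).continuousAt.const_mul A)
    refine ContinuousAt.comp (f := fun t : ℝ => x + t • e) ?_ (hline 0).continuousAt
    simpa using hu.continuousAt
  have h := hmax0.deriv_deriv_nonpos hcont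
  rw [hderiv.deriv_eq, hsecond.deriv] at h
  linarith

/-- A function with gradient bounded by one on a ball has bounded Laplacian from above at some
point of the ball. -/
lemma exists_trace_Hess_le {u : Euc n → ℝ} {y : Euc n} {r : ℝ} (hr : 0 < r)
    (hu : ∀ x ∈ Metric.closedBall y r, ContDiffAt ℝ 2 u x)
    (hgrad : ∀ x ∈ Metric.closedBall y r, ‖gradient u x‖ ≤ 1) :
    ∃ x ∈ Metric.closedBall y r, (Hess u x).trace ≤ n * (2 * (2 / r)) := by
  have hcont : ContinuousOn (fun z => u z - 2 / r * ‖z - y‖ ^ 2) (Metric.closedBall y r) := by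
    refine ContinuousOn.sub (fun x hx => (hu x hx).continuousAt.continuousWithinAt) ?_
    fun_prop
  obtain ⟨x, hx, hmax⟩ := (isCompact_closedBall y r).exists_isMaxOn
    ⟨y, Metric.mem_closedBall_self hr.le⟩ hcont
  have hlip : ‖u x - u y‖ ≤ 1 * ‖x - y‖ :=
    (convex_closedBall y r).norm_image_sub_le_of_norm_fderiv_le (𝕜 := ℝ)
      (fun z hz => (hu z hz).differentiableAt (by norm_num))
      (fun z hz => by simpa [gradient] using hgrad z hz)
      (Metric.mem_closedBall_self hr.le) hx
  have hxball : x ∈ Metric.ball y r := by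
    rw [mem_ball_iff_norm]
    by_contra! hge
    have heq : ‖x - y‖ = r := le_antisymm (mem_closedBall_iff_norm.mp hx) hge
    have hy : u y - 2 / r * ‖y - y‖ ^ 2 ≤ u x - 2 / r * ‖x - y‖ ^ 2 :=
      hmax (Metric.mem_closedBall_self hr.le)
    have h2r : 2 / r * r ^ 2 = 2 * r := by field_simp
    rw [heq, Real.norm_eq_abs, one_mul] at hlip
    rw [heq, h2r] at hy
    simp at hy
    linarith [le_abs_self (u x - u y)]
  have hloc : IsLocalMax (fun z => u z - 2 / r * ‖z - y‖ ^ 2) x :=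
    hmax.isLocalMax (Filter.mem_of_superset (Metric.isOpen_ball.mem_nhds hxball)
      Metric.ball_subset_closedBall)
  refine ⟨x, hx, ?_⟩
  calc (Hess u x).trace ≤ ∑ _i : Fin n, 2 * (2 / r) :=
        Finset.sum_le_sum fun i _ => Hess_diag_le_of_isLocalMax (hu x hx) hloc i
    _ = n * (2 * (2 / r)) := by simp

/-- The measure of the gradient image is controlled by an upper bound for the Laplacian. -/
lemma volume_gradient_image_le {u : Euc n → ℝ} {Ω : Set (Euc n)} {m : ℝ} (hn : 0 < n)
    (hΩ : IsOpen Ω) (hfin : volume Ω ≠ ⊤) (hu : ∀ x ∈ Ω, ContDiffAt ℝ 2 u x)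
    (hH : ∀ x ∈ Ω, (Hess u x).PosSemidef) (hm : ∀ x ∈ Ω, (Hess u x).trace ≤ m) (hm0 : 0 ≤ m) :
    (volume (gradient u '' Ω)).toReal ≤ (m / n) ^ n * (volume Ω).toReal := by
  have hle : volume (gradient u '' Ω) ≤ ENNReal.ofReal ((m / n) ^ n) * volume Ω :=
    calc volume (gradient u '' Ω)
        ≤ ∫⁻ x in Ω, ENNReal.ofReal |(gradDeriv u x).det| :=
          addHaar_image_le_lintegral_abs_det_fderiv volume hΩ.measurableSet
            fun x hx => (hu x hx).hasFDerivAt_gradient.hasFDerivWithinAt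
      _ ≤ ∫⁻ _x in Ω, ENNReal.ofReal ((m / n) ^ n) := by
          refine setLIntegral_mono measurable_const fun x hx => ENNReal.ofReal_le_ofReal ?_
          rw [det_gradDeriv, abs_of_nonneg (hH x hx).det_nonneg]
          refine ((hH x hx).det_le_trace_div_pow hn).trans ?_
          have := (hH x hx).trace_nonneg
          gcongr
          exact hm x hx
      _ = _ := setLIntegral_const _ _
  have := ENNReal.toReal_mono (ENNReal.mul_ne_top ENNReal.ofReal_ne_top hfin) hle
  rwa [ENNReal.toReal_mul, ENNReal.toReal_ofReal (by positivity)] at this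

theorem statement_12 {n : ℕ} (hn : 2 ≤ n)
    (Ω Ωt : Set (Euc n)) (ht h : Euc n → ℝ) (θt θ : ℝ)
    (hdom : DomainSetup Ω Ωt ht h θt θ)
    (hball : closure Ωt ⊆ Metric.ball (0 : Euc n) 1)
    (f : Euc n × Euc n → ℝ)
    (hf : ContDiffOn ℝ 2 f (closure Ω ×ˢ closure Ωt))
    (hosc : OSCcond Ω Ωt f) :
    ∃ C₁₇ C₁₈ C₁₉ : ℝ, 0 < C₁₇ ∧ 0 < C₁₈ ∧ 0 < C₁₉ ∧
      ∀ α : ℝ, α ∈ Set.Ioo (0 : ℝ) 1 →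
      ∀ (c : ℝ) (u : Euc n → ℝ), IsUCSol Ω Ωt f c u →
        (∃ C : ℝ≥0, HolderOnWith C (Real.toNNReal α)
            (fun x => iteratedFDeriv ℝ 2 u x) (closure Ω)) →
        (∀ x ∈ closure Ω, MatLE (Hess u x) (C₁₇ • (1 : Matrix (Fin n) (Fin n) ℝ))) ∧
        (∀ x ∈ closure Ω, C₁₈ ≤ (Hess u x).trace ∧ (Hess u x).trace ≤ C₁₉) := by
  obtain ⟨hΩ, hΩt, hΩb, hΩtb, hΩne, hΩtne, -⟩ := hdom
  have hn0 : 0 < n := by omega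
  have hnR : (0 : ℝ) < n := by exact_mod_cast hn0
  obtain ⟨r, hr, hrΩt⟩ : ∃ r < 1, ∀ p ∈ Ωt, ‖p‖ ≤ r := by
    obtain ⟨q, hq, hmax⟩ := hΩtb.isCompact_closure.exists_isMaxOn hΩtne.closure
      continuous_norm.continuousOn
    exact ⟨‖q‖, by simpa using hball hq, fun p hp => hmax (subset_closure hp)⟩
  have hr0 : 0 ≤ r := by
    obtain ⟨p, hp⟩ := hΩtne
    exact (norm_nonneg p).trans (hrΩt p hp)
  obtain ⟨y, hy⟩ := hΩne
  obtain ⟨ρ, hρ, hρΩ⟩ := Metric.nhds_basis_closedBall.mem_iff.mp (hΩ.mem_nhds hy)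
  have hvol : 0 < (volume Ω).toReal :=
    ENNReal.toReal_pos (hΩ.measure_pos volume ⟨y, hy⟩).ne' hΩb.measure_lt_top.ne
  have hvolt : 0 < (volume Ωt).toReal :=
    ENNReal.toReal_pos (hΩt.measure_pos volume hΩtne).ne' hΩtb.measure_lt_top.ne
  have hratio : 0 < (volume Ωt).toReal / (volume Ω).toReal := div_pos hvolt hvol
  set R := ((volume Ωt).toReal / (volume Ω).toReal) ^ ((1 : ℝ) / n) with hR
  have hRpos : 0 < R := Real.rpow_pos_of_pos hratio _
  set K := (√(1 - r ^ 2))⁻¹ ^ 3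
  have hK : 0 < K := pow_pos (inv_pos.mpr (Real.sqrt_pos.mpr (by nlinarith))) 3
  have hC₁₉ : 0 < K * (n * (2 * (2 / ρ))) + n / 2 * R := by positivity
  refine ⟨K * (n * (2 * (2 / ρ))) + n / 2 * R, K⁻¹ * (n / 2 * R),
    K * (n * (2 * (2 / ρ))) + n / 2 * R, hC₁₉, by positivity, hC₁₉, ?_⟩
  rintro α hα c u ⟨huC, ⟨δ, hδ, huδ⟩, hgrad, heq, himage⟩ ⟨C, hC⟩
  have hu : ∀ x ∈ Ω, ContDiffAt ℝ 2 u x := fun x hx =>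
    huC.contDiffAt (Filter.mem_of_superset (hΩ.mem_nhds hx) subset_closure)
  have hH : ∀ x ∈ closure Ω, (Hess u x).PosSemidef := fun x hx =>
    posSemidef_of_smul_one_matLE hδ (huδ x hx)
  have hgradmem : ∀ x ∈ Ω, gradient u x ∈ Ωt := fun x hx => himage ▸ mem_image_of_mem _ hx
  have hlow : ∀ x ∈ Ω, (Hess u x).trace ≤ MinkDiv u x := fun x hx =>
    trace_le_minkDiv (hu x hx) (hgrad x (subset_closure hx)) (hH x (subset_closure hx))
  have hup : ∀ x ∈ Ω, MinkDiv u x ≤ K * (Hess u x).trace := fun x hx =>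
    minkDiv_le_mul_trace (hu x hx) hr (hrΩt _ (hgradmem x hx)) (hH x (subset_closure hx))
  have hoscM : ∀ x ∈ Ω, ∀ z ∈ Ω, MinkDiv u z ≤ MinkDiv u x + n / 2 * R := by
    intro x hx z hz
    have := (abs_le.mp (hosc z (subset_closure hz) x (subset_closure hx) _
      (subset_closure (hgradmem z hz)) _ (subset_closure (hgradmem x hx)))).2
    rw [heq x hx, heq z hz]
    linarith
  obtain ⟨x₁, hx₁, htr₁⟩ := exists_trace_Hess_le hρ (fun x hx => hu x (hρΩ hx))
    fun x hx => (hgrad x (subset_closure (hρΩ hx))).le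
  have hboundsΩ : ∀ x ∈ Ω, (Hess u x).trace ∈
      Icc (K⁻¹ * (n / 2 * R)) (K * (n * (2 * (2 / ρ))) + n / 2 * R) := by
    intro x hx
    constructor
    · have hm0 : 0 ≤ MinkDiv u x + n / 2 * R := by
        have := (hH x (subset_closure hx)).trace_nonneg.trans (hlow x hx)
        positivity
      have hmeas := volume_gradient_image_le hn0 hΩ hΩb.measure_lt_top.ne hu
        (fun z hz => hH z (subset_closure hz))
        (fun z hz => (hlow z hz).trans (hoscM x hx z hz)) hm0
      rw [himage, ← div_le_iff₀ hvol] at hmeas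
      have hRle : R ≤ (MinkDiv u x + n / 2 * R) / n := by
        have hpow := Real.rpow_le_rpow hratio.le hmeas (z := (1 : ℝ) / n) (by positivity)
        rwa [one_div, Real.pow_rpow_inv_natCast (div_nonneg hm0 hnR.le) hn0.ne',
          ← one_div, ← hR] at hpow
      rw [le_div_iff₀ hnR] at hRle
      rw [inv_mul_le_iff₀ hK]
      linarith [hup x hx]
    · calc (Hess u x).trace ≤ MinkDiv u x := hlow x hx
        _ ≤ MinkDiv u x₁ + n / 2 * R := hoscM x₁ (hρΩ hx₁) x hx
        _ ≤ K * (Hess u x₁).trace + n / 2 * R := by gcongr; exact hup x₁ (hρΩ hx₁)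
        _ ≤ _ := by gcongr
  have htrace : ContinuousOn (fun x => (Hess u x).trace) (closure Ω) := by
    have hcont := hC.continuousOn (Real.toNNReal_pos.mpr hα.1)
    refine continuousOn_finsetSum _ fun i _ => ?_
    exact (ContinuousMultilinearMap.apply ℝ (fun _ : Fin 2 => Euc n) ℝ
      ![EuclideanSpace.single i 1, EuclideanSpace.single i 1]).continuous.comp_continuousOn hcont
  have hbounds : ∀ x ∈ closure Ω, (Hess u x).trace ∈
      Icc (K⁻¹ * (n / 2 * R)) (K * (n * (2 * (2 / ρ))) + n / 2 * R) := fun x hx =>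
    isClosed_Icc.closure_subset (MapsTo.closure_of_continuousOn hboundsΩ htrace hx)
  exact ⟨fun x hx => (hH x hx).le_trace_smul_one (hbounds x hx).2, hbounds⟩

end
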